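/- arXiv:2403.16636 — 2 statements merged into one kernel-verified Lean document; each statement's English description precedes it below -/
import Mathlib

section
/- Fix an integer n ≥ 1, let q : V → ℂⁿ be analytic on an open set V ⊆ ℂ, and let φ(z) = (az+b)/(cz+d) be a Möbius transformation (a, b, c, d ∈ ℂ, ad − bc ≠ 0). Then for every z ∈ ℂ with cz + d ≠ 0, φ(z) ∈ V and Δ(q)(φ(z)) ≠ 0, one has I_0(q ∘ φ)(z) = ((n+2)/(2n))·(I_n(q ∘ φ)(z))² + (φ'(z))²·( I_0(q)(φ(z)) − ((n+2)/(2n))·(I_n(q)(φ(z)))² ). -/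
/-- `D(u)(z)`: the `n×n` matrix whose columns are `u'(z), u''(z), …, u⁽ⁿ⁾(z)`. -/
noncomputable def Dmat (n : ℕ) (u : ℂ → (Fin n → ℂ)) (z : ℂ) : Matrix (Fin n) (Fin n) ℂ :=
  Matrix.of fun (i j : Fin n) => iteratedDeriv (j.1 + 1) u z i

/-- `Δ(u)(z) := det D(u)(z)`. -/
noncomputable def Δmat (n : ℕ) (u : ℂ → (Fin n → ℂ)) (z : ℂ) : ℂ :=
  (Dmat n u z).det

/-- `A_i(u)(z)`: the determinant obtained from `Δ(u)(z)` by replacing the column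
`u⁽ⁱ⁾(z)` with `u⁽ⁿ⁺¹⁾(z)` (the index `i : Fin n` encodes `i+1 ∈ {1,…,n}`). -/
noncomputable def Ainv (n : ℕ) (u : ℂ → (Fin n → ℂ)) (i : Fin n) (z : ℂ) : ℂ :=
  (Matrix.of fun (r j : Fin n) =>
    if j = i then iteratedDeriv (n + 1) u z r else iteratedDeriv (j.1 + 1) u z r).det

/-- `I_i(u)(z) := A_i(u)(z)/Δ(u)(z)` (the index `i : Fin n` encodes `i+1 ∈ {1,…,n}`). -/
noncomputable def Iinv (n : ℕ) (u : ℂ → (Fin n → ℂ)) (i : Fin n) (z : ℂ) : ℂ :=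
  Ainv n u i z / Δmat n u z

/-- `I_0(u)(z) := det[u'(z), …, u⁽ⁿ⁻¹⁾(z), u⁽ⁿ⁺²⁾(z)] / Δ(u)(z)`. -/
noncomputable def I0inv (n : ℕ) (u : ℂ → (Fin n → ℂ)) (z : ℂ) : ℂ :=
  (Matrix.of fun (r j : Fin n) =>
    if j.1 = n - 1 then iteratedDeriv (n + 2) u z r else iteratedDeriv (j.1 + 1) u z r).det /
    Δmat n u z

/-- The coefficients `M m k` in
`(q ∘ φ)⁽ᵐ⁺¹⁾(z) = ∑ k ≤ m, M m k · (c z + d)^(-(m + k + 2)) · q⁽ᵏ⁺¹⁾(φ z)`,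
where `φ z = (a z + b) / (c z + d)` and `D = a d - b c`. -/
def moebiusCoeff (c D : ℂ) : ℕ → ℕ → ℂ
  | 0, 0 => D
  | 0, _ + 1 => 0
  | m + 1, 0 => -c * (m + 2) * moebiusCoeff c D m 0
  | m + 1, k + 1 =>
      -c * (m + k + 3) * moebiusCoeff c D m (k + 1) + D * moebiusCoeff c D m k

lemma moebiusCoeff_of_lt (c D : ℂ) (m k : ℕ) (hk : m < k) : moebiusCoeff c D m k = 0 := by
  induction m generalizing k with
  | zero => obtain _ | k := k <;> simp_all [moebiusCoeff]
  | succ m ih =>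
    obtain _ | k := k
    · omega
    · simp [moebiusCoeff, ih (k + 1) (by omega), ih k (by omega)]

lemma moebiusCoeff_self (c D : ℂ) (m : ℕ) : moebiusCoeff c D m m = D ^ (m + 1) := by
  induction m with
  | zero => simp [moebiusCoeff]
  | succ m ih => rw [moebiusCoeff, ih, moebiusCoeff_of_lt c D m (m + 1) (by omega)]; ring

lemma moebiusCoeff_succ_self (c D : ℂ) (m : ℕ) :
    moebiusCoeff c D (m + 1) m = -c * (m + 1) * (m + 2) * D ^ (m + 1) := by
  induction m with
  | zero => simp [moebiusCoeff]
  | succ m ih => rw [moebiusCoeff, ih, moebiusCoeff_self]; push_cast; ring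

lemma moebiusCoeff_add_two_self (c D : ℂ) (m : ℕ) :
    moebiusCoeff c D (m + 2) m =
      c ^ 2 * (m + 1) * (m + 2) ^ 2 * (m + 3) / 2 * D ^ (m + 1) := by
  induction m with
  | zero => simp [moebiusCoeff]; ring
  | succ m ih => rw [moebiusCoeff, ih, moebiusCoeff_succ_self]; push_cast; ring

lemma hasDerivAt_moebius {a b c d z : ℂ} (hz : c * z + d ≠ 0) :
    HasDerivAt (fun z => (a * z + b) / (c * z + d))
      ((a * d - b * c) * (c * z + d)⁻¹ ^ 2) z := by
  have h1 : HasDerivAt (fun z => a * z + b) a z := by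
    simpa using ((hasDerivAt_id z).const_mul a).add_const b
  have h2 : HasDerivAt (fun z => c * z + d) c z := by
    simpa using ((hasDerivAt_id z).const_mul c).add_const d
  refine (h1.fun_div h2 hz).congr_deriv ?_
  field_simp
  ring

lemma hasDerivAt_inv_linear_pow {c d z : ℂ} (hz : c * z + d ≠ 0) (N : ℕ) :
    HasDerivAt (fun z => (c * z + d)⁻¹ ^ N) (-c * N * (c * z + d)⁻¹ ^ (N + 1)) z := by
  have h2 : HasDerivAt (fun z => c * z + d) c z := by
    simpa using ((hasDerivAt_id z).const_mul c).add_const d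
  refine ((h2.fun_inv hz).fun_pow N).congr_deriv ?_
  obtain _ | N := N
  · simp
  · simp only [Nat.add_sub_cancel, div_eq_mul_inv, ← inv_pow]
    push_cast
    ring

lemma iteratedDeriv_comp_moebius {E : Type*} [NormedAddCommGroup E] [NormedSpace ℂ E]
    [CompleteSpace E] {V : Set ℂ} (hV : IsOpen V) {q : ℂ → E} (hq : ∀ w ∈ V, AnalyticAt ℂ q w)
    {a b c d : ℂ} {φ : ℂ → ℂ} (hφ : ∀ z, φ z = (a * z + b) / (c * z + d)) (m : ℕ)
    {z : ℂ} (hz : c * z + d ≠ 0) (hzV : φ z ∈ V) :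
    iteratedDeriv (m + 1) (q ∘ φ) z =
      ∑ k ∈ Finset.range (m + 1),
        (moebiusCoeff c (a * d - b * c) m k * (c * z + d)⁻¹ ^ (m + k + 2)) •
          iteratedDeriv (k + 1) q (φ z) := by
  have hφ' : ∀ {z : ℂ}, c * z + d ≠ 0 →
      HasDerivAt φ ((a * d - b * c) * (c * z + d)⁻¹ ^ 2) z := fun hz => by
    rw [funext hφ]; exact hasDerivAt_moebius hz
  have hqk : ∀ (k : ℕ) {w : ℂ}, w ∈ V →
      HasDerivAt (iteratedDeriv k q) (iteratedDeriv (k + 1) q w) w := fun k w hw => by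
    rw [iteratedDeriv_succ]
    have := (hq w hw).iterated_deriv k
    rw [← iteratedDeriv_eq_iterate] at this
    exact this.differentiableAt.hasDerivAt
  induction m generalizing z with
  | zero =>
    have := (hqk 0 hzV).scomp z (hφ' hz)
    rw [iteratedDeriv_zero] at this
    simpa [moebiusCoeff] using this.deriv
  | succ m ih =>
    have hev : iteratedDeriv (m + 1) (q ∘ φ) =ᶠ[nhds z] fun z =>
        ∑ k ∈ Finset.range (m + 1),
          (moebiusCoeff c (a * d - b * c) m k * (c * z + d)⁻¹ ^ (m + k + 2)) •
            iteratedDeriv (k + 1) q (φ z) := by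
      have h1 : ∀ᶠ y in nhds z, c * y + d ≠ 0 :=
        ContinuousAt.eventually_ne (by fun_prop) hz
      have h2 : ∀ᶠ y in nhds z, φ y ∈ V :=
        (hφ' hz).continuousAt.eventually (hV.mem_nhds hzV)
      filter_upwards [h1, h2] with y hy1 hy2 using ih hy1 hy2
    rw [iteratedDeriv_succ, hev.deriv_eq]
    have hsum := HasDerivAt.fun_sum (u := Finset.range (m + 1)) fun k _ =>
      ((hasDerivAt_inv_linear_pow hz (m + k + 2)).const_mul
        (moebiusCoeff c (a * d - b * c) m k)).smul ((hqk (k + 1) hzV).scomp z (hφ' hz))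
    refine hsum.deriv.trans ?_
    set D := a * d - b * c
    set s := (c * z + d)⁻¹
    let f : ℕ → E := fun k =>
      (-c * (m + k + 2) * moebiusCoeff c D m k * s ^ (m + k + 3)) • iteratedDeriv (k + 1) q (φ z)
    let g : ℕ → E := fun k =>
      (D * moebiusCoeff c D m k * s ^ (m + k + 4)) • iteratedDeriv (k + 2) q (φ z)
    have hf : ∑ k ∈ Finset.range (m + 1), f (k + 1) + f 0 = ∑ k ∈ Finset.range (m + 1), f k := by
      rw [← Finset.sum_range_succ', Finset.sum_range_succ]
      simp [f, moebiusCoeff_of_lt c D m (m + 1) (by omega)]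
    calc
      _ = ∑ k ∈ Finset.range (m + 1), (g k + f k) := by
        refine Finset.sum_congr rfl fun k _ => ?_
        simp only [f, g, smul_smul, Function.comp_apply]
        congr 2 <;> push_cast <;> ring
      _ = ∑ k ∈ Finset.range (m + 1), (f (k + 1) + g k) + f 0 := by
        rw [Finset.sum_add_distrib, Finset.sum_add_distrib, ← hf]
        abel
      _ = _ := by
        rw [Finset.sum_range_succ' _ (m + 1)]
        congr 1
        · refine Finset.sum_congr rfl fun k _ => ?_
          simp only [f, g, ← add_smul, moebiusCoeff]
          congr 1
          push_cast
          ring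
        · simp only [f, moebiusCoeff]
          congr 1
          push_cast
          ring

/-- Changing the family `u` by a lower triangular system of coefficients `t` multiplies
`det[u 0, …, u (m-1), x]` by the product of the diagonal coefficients. -/
lemma cramer_last_of_triangular {R : Type*} [CommRing R] (m : ℕ) (u v : ℕ → Fin (m + 1) → R)
    (t : ℕ → ℕ → R) (hv : ∀ k, v k = ∑ j ∈ Finset.range (k + 1), t k j • u j)
    (x : Fin (m + 1) → R) :
    (Matrix.of fun r j : Fin (m + 1) => v j r).cramer x (Fin.last m) =
      (∏ k ∈ Finset.range m, t k k) *
        (Matrix.of fun r j : Fin (m + 1) => u j r).cramer x (Fin.last m) := by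
  rw [Matrix.cramer_apply, Matrix.cramer_apply]
  let C : Matrix (Fin (m + 1)) (Fin (m + 1)) R := Matrix.of fun i j =>
    if j = Fin.last m then (if i = Fin.last m then 1 else 0)
    else if i ≤ j then t j i else 0
  have hC : C.det = ∏ k ∈ Finset.range m, t k k := by
    rw [Matrix.det_of_isUpperTriangular, Fin.prod_univ_castSucc, Finset.prod_range]
    · simp [C, Fin.castSucc_ne_last]
    · intro i j hij
      have h1 : j ≠ Fin.last m := fun h => by
        subst h; exact absurd hij (not_lt.mpr (Fin.le_last i))
      simp only [id_eq] at hij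
      simp [C, h1, not_le.mpr hij]
  rw [← hC, mul_comm, ← Matrix.det_mul]
  congr 1
  ext r j
  rw [Matrix.mul_apply, Fin.sum_univ_castSucc]
  refine Fin.lastCases ?_ (fun j => ?_) j
  · simp [C, Fin.castSucc_ne_last]
  · simp only [C, Matrix.updateCol_apply, Matrix.of_apply, Fin.castSucc_ne_last, if_false, hv,
      Fin.castSucc_le_castSucc_iff, Fin.val_castSucc, if_true]
    rw [if_neg (not_le.mpr (Fin.castSucc_lt_last j)), mul_zero, add_zero]
    simp only [Fin.le_def]
    rw [Fin.sum_univ_eq_sum_range (fun i => u i r * if i ≤ j.1 then t j i else 0) m,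
      Finset.sum_apply]
    refine (Finset.sum_congr rfl fun i hi => ?_).trans
      (Finset.sum_subset (Finset.range_subset_range.mpr j.2) fun i _ hi => ?_)
    · rw [if_pos (by simpa [Nat.lt_succ_iff] using hi), Pi.smul_apply, smul_eq_mul, mul_comm]
    · rw [if_neg (by simpa [Nat.lt_succ_iff] using hi), mul_zero]

lemma cramer_last_self {R : Type*} [CommRing R] (m : ℕ) (u : ℕ → Fin (m + 1) → R) {k : ℕ}
    (hk : k < m) :
    (Matrix.of fun r j : Fin (m + 1) => u j r).cramer (u k) (Fin.last m) = 0 := by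
  rw [Matrix.cramer_apply]
  have hne : (⟨k, by omega⟩ : Fin (m + 1)) ≠ Fin.last m := by
    simp [Fin.ext_iff]; omega
  refine Matrix.det_zero_of_column_eq hne fun r => ?_
  simp [hne]

lemma Δmat_succ_eq_cramer (m : ℕ) (u : ℂ → Fin (m + 1) → ℂ) (z : ℂ) :
    Δmat (m + 1) u z = (Matrix.of fun r j : Fin (m + 1) =>
      iteratedDeriv (j + 1) u z r).cramer (iteratedDeriv (m + 1) u z) (Fin.last m) := by
  rw [Matrix.cramer_apply, Δmat, Dmat]
  congr 1
  ext r j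
  by_cases hj : j = Fin.last m <;> simp [hj]

lemma Ainv_succ_eq_cramer (m : ℕ) (u : ℂ → Fin (m + 1) → ℂ) (z : ℂ) :
    Ainv (m + 1) u (Fin.last m) z = (Matrix.of fun r j : Fin (m + 1) =>
      iteratedDeriv (j + 1) u z r).cramer (iteratedDeriv (m + 2) u z) (Fin.last m) := by
  rw [Matrix.cramer_apply, Ainv]
  congr 1
  ext r j
  simp [Matrix.updateCol_apply]

lemma I0inv_succ_eq_cramer (m : ℕ) (u : ℂ → Fin (m + 1) → ℂ) (z : ℂ) :
    I0inv (m + 1) u z = (Matrix.of fun r j : Fin (m + 1) =>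
      iteratedDeriv (j + 1) u z r).cramer (iteratedDeriv (m + 3) u z) (Fin.last m) /
        Δmat (m + 1) u z := by
  rw [Matrix.cramer_apply, I0inv]
  congr 2
  ext r j
  simp [Matrix.updateCol_apply, Fin.ext_iff]

/-- Eq. `K0`: for a Möbius transformation `φ`,
`I_0(q∘φ) = ((n+2)/(2n))·I_n(q∘φ)² + (φ')²·(I_0(q)∘φ − ((n+2)/(2n))·(I_n(q)∘φ)²)`. -/
theorem I0_comp_moebius (n : ℕ) (hn : 1 ≤ n) (V : Set ℂ) (hV : IsOpen V)
    (q : ℂ → (Fin n → ℂ)) (hq : ∀ w ∈ V, AnalyticAt ℂ q w)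
    (a b c d : ℂ) (h : a * d - b * c ≠ 0)
    (φ : ℂ → ℂ) (hφ : ∀ z, φ z = (a * z + b) / (c * z + d))
    (z : ℂ) (hz : c * z + d ≠ 0) (hzV : φ z ∈ V) (hΔ : Δmat n q (φ z) ≠ 0) :
    I0inv n (q ∘ φ) z =
      ((n : ℂ) + 2) / (2 * n) * (Iinv n (q ∘ φ) ⟨n - 1, by omega⟩ z) ^ 2 +
        (deriv φ z) ^ 2 *
          (I0inv n q (φ z) - ((n : ℂ) + 2) / (2 * n) * (Iinv n q ⟨n - 1, by omega⟩ (φ z)) ^ 2) := by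
  obtain ⟨m, rfl⟩ : ∃ m, n = m + 1 := ⟨n - 1, by omega⟩
  have hlast : (⟨m + 1 - 1, by omega⟩ : Fin (m + 1)) = Fin.last m := rfl
  have hdφ : deriv φ z = (a * d - b * c) * (c * z + d)⁻¹ ^ 2 := by
    rw [funext hφ]; exact (hasDerivAt_moebius hz).deriv
  rw [hlast, hdφ, Iinv, Iinv, I0inv_succ_eq_cramer, I0inv_succ_eq_cramer]
  rw [Δmat_succ_eq_cramer] at hΔ
  simp only [Δmat_succ_eq_cramer, Ainv_succ_eq_cramer]
  set D := a * d - b * c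
  set s := (c * z + d)⁻¹
  have hs0 : s ≠ 0 := inv_ne_zero hz
  let u : ℕ → Fin (m + 1) → ℂ := fun k => iteratedDeriv (k + 1) q (φ z)
  let v : ℕ → Fin (m + 1) → ℂ := fun k => iteratedDeriv (k + 1) (q ∘ φ) z
  let t : ℕ → ℕ → ℂ := fun m k => moebiusCoeff c D m k * s ^ (m + k + 2)
  have hv : ∀ k, v k = ∑ j ∈ Finset.range (k + 1), t k j • u j := fun k =>
    iteratedDeriv_comp_moebius hV hq hφ k hz hzV
  let P : ℂ := ∏ k ∈ Finset.range m, t k k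
  have hP : P ≠ 0 := Finset.prod_ne_zero_iff.mpr fun k _ => by
    simp only [t, moebiusCoeff_self]
    exact mul_ne_zero (pow_ne_zero _ h) (pow_ne_zero _ hs0)
  let G : (Fin (m + 1) → ℂ) → ℂ := fun x =>
    (Matrix.of fun r j : Fin (m + 1) => u j r).cramer x (Fin.last m)
  have hG : ∀ x, (Matrix.of fun r j : Fin (m + 1) => v j r).cramer x (Fin.last m) = P * G x :=
    cramer_last_of_triangular m u v t hv
  have hGv : ∀ k, G (v (m + k)) = ∑ j ∈ Finset.range (k + 1), t (m + k) (m + j) * G (u (m + j)) := by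
    intro k
    simp only [G, hv, map_sum, map_smul, Finset.sum_apply, Pi.smul_apply, smul_eq_mul]
    rw [add_assoc, Finset.sum_range_add, Finset.sum_eq_zero, zero_add]
    intro j hj
    rw [cramer_last_self m u (Finset.mem_range.mp hj), mul_zero]
  have e0 := hGv 0
  have e1 := hGv 1
  have e2 := hGv 2
  simp only [Finset.sum_range_succ, Finset.sum_range_zero, zero_add, add_zero, t,
    moebiusCoeff_self, moebiusCoeff_succ_self, moebiusCoeff_add_two_self] at e0 e1 e2
  change G (u m) ≠ 0 at hΔ
  change (Matrix.of fun r j : Fin (m + 1) => v j r).cramer (v (m + 2)) (Fin.last m) /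
      (Matrix.of fun r j : Fin (m + 1) => v j r).cramer (v m) (Fin.last m) =
    _ * ((Matrix.of fun r j : Fin (m + 1) => v j r).cramer (v (m + 1)) (Fin.last m) /
      (Matrix.of fun r j : Fin (m + 1) => v j r).cramer (v m) (Fin.last m)) ^ 2 +
      _ * (G (u (m + 2)) / G (u m) - _ * (G (u (m + 1)) / G (u m)) ^ 2)
  have hm : (m : ℂ) + 1 ≠ 0 := Nat.cast_add_one_ne_zero m
  rw [hG, hG, hG, mul_div_mul_left _ _ hP, mul_div_mul_left _ _ hP, e0, e1, e2]
  clear_value G u s D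
  push_cast
  field_simp
  ring
end

section
/- Let n = 3, let q : V → ℂ³ be analytic on an open set V ⊆ ℂ, and let ω(z) = (az+b)/(cz+d) be a Möbius transformation (ad − bc ≠ 0). Then for every z ∈ ℂ with cz + d ≠ 0, ω(z) ∈ V and Δ(q)(ω(z)) ≠ 0, the following three identities hold at z (writing ω', ω'' for the first and second derivatives of ω at z, and evaluating I_j(q) at ω(z)): (1) ω'³·I₁(q∘ω) = 3ω''³ + (3/2)·ω'²ω''²·I₃(q)(ω) − ω'⁴ω''·I₂(q)(ω) + ω'⁶·I₁(q)(ω); (2) ω'²·I₂(q∘ω) = −9ω''² + ω'⁴·I₂(q)(ω) − 3ω'²ω''·I₃(q)(ω); (3) ω'·I₃(q∘ω) = 6ω'' + ω'²·I₃(q)(ω). -/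
open Topology Filter

theorem AnalyticAt.hasDerivAt_iteratedDeriv {E : Type*} [NormedAddCommGroup E] [NormedSpace ℂ E]
    [CompleteSpace E] {f : ℂ → E} {x : ℂ} (hf : AnalyticAt ℂ f x) (k : ℕ) :
    HasDerivAt (iteratedDeriv k f) (iteratedDeriv (k + 1) f x) x := by
  rw [iteratedDeriv_succ]
  have hk : AnalyticAt ℂ (iteratedDeriv k f) x := by
    rw [iteratedDeriv_eq_iterate]
    exact hf.iterated_deriv k
  exact hk.differentiableAt.hasDerivAt

theorem iteratedDeriv_succ_eventuallyEq {E : Type*} [NormedAddCommGroup E] [NormedSpace ℂ E]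
    {f g g' : ℂ → E} {x : ℂ} {k : ℕ} (hfg : iteratedDeriv k f =ᶠ[𝓝 x] g)
    (hg : ∀ᶠ y in 𝓝 x, HasDerivAt g (g' y) y) :
    iteratedDeriv (k + 1) f =ᶠ[𝓝 x] g' := by
  filter_upwards [hfg.eventuallyEq_nhds, hg] with y hy hgy
  rw [iteratedDeriv_succ, hy.deriv_eq, hgy.deriv]

section Composition

variable {E : Type*} [NormedAddCommGroup E] [NormedSpace ℂ E] [CompleteSpace E]
  {q : ℂ → E} {ω : ℂ → ℂ} {x : ℂ}

theorem hasDerivAt_iteratedDeriv_comp (hq : AnalyticAt ℂ q (ω x)) (hω : AnalyticAt ℂ ω x) (k : ℕ) :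
    HasDerivAt (fun y => iteratedDeriv k q (ω y))
      (iteratedDeriv 1 ω x • iteratedDeriv (k + 1) q (ω x)) x := by
  rw [iteratedDeriv_one]
  exact (hq.hasDerivAt_iteratedDeriv k).scomp x hω.differentiableAt.hasDerivAt

theorem iteratedDeriv_comp_eventuallyEq (hq : AnalyticAt ℂ q (ω x)) (hω : AnalyticAt ℂ ω x) :
    iteratedDeriv 1 (q ∘ ω) =ᶠ[𝓝 x]
        (fun y => iteratedDeriv 1 ω y • iteratedDeriv 1 q (ω y)) ∧
      iteratedDeriv 2 (q ∘ ω) =ᶠ[𝓝 x] (fun y => iteratedDeriv 2 ω y • iteratedDeriv 1 q (ω y) +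
        iteratedDeriv 1 ω y ^ 2 • iteratedDeriv 2 q (ω y)) ∧
      iteratedDeriv 3 (q ∘ ω) =ᶠ[𝓝 x] (fun y => iteratedDeriv 3 ω y • iteratedDeriv 1 q (ω y) +
        (3 * iteratedDeriv 1 ω y * iteratedDeriv 2 ω y) • iteratedDeriv 2 q (ω y) +
        iteratedDeriv 1 ω y ^ 3 • iteratedDeriv 3 q (ω y)) ∧
      iteratedDeriv 4 (q ∘ ω) =ᶠ[𝓝 x] (fun y => iteratedDeriv 4 ω y • iteratedDeriv 1 q (ω y) +
        (3 * iteratedDeriv 2 ω y ^ 2 + 4 * iteratedDeriv 1 ω y * iteratedDeriv 3 ω y) •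
          iteratedDeriv 2 q (ω y) +
        (6 * iteratedDeriv 1 ω y ^ 2 * iteratedDeriv 2 ω y) • iteratedDeriv 3 q (ω y) +
        iteratedDeriv 1 ω y ^ 4 • iteratedDeriv 4 q (ω y)) := by
  have hev : ∀ᶠ y in 𝓝 x, AnalyticAt ℂ q (ω y) ∧ AnalyticAt ℂ ω y :=
    (hω.continuousAt.eventually hq.eventually_analyticAt).and hω.eventually_analyticAt
  have h1 : iteratedDeriv 1 (q ∘ ω) =ᶠ[𝓝 x]
      (fun y => iteratedDeriv 1 ω y • iteratedDeriv 1 q (ω y)) := by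
    refine iteratedDeriv_succ_eventuallyEq (g := q ∘ ω) (by simp) ?_
    filter_upwards [hev] with y ⟨hqy, hωy⟩
    simpa [Function.comp_def] using hasDerivAt_iteratedDeriv_comp hqy hωy 0
  have h2 := iteratedDeriv_succ_eventuallyEq (g' := fun y =>
      iteratedDeriv 2 ω y • iteratedDeriv 1 q (ω y) +
        iteratedDeriv 1 ω y ^ 2 • iteratedDeriv 2 q (ω y)) h1 (by
    filter_upwards [hev] with y ⟨hqy, hωy⟩
    refine ((hωy.hasDerivAt_iteratedDeriv 1).smul
      (hasDerivAt_iteratedDeriv_comp hqy hωy 1)).congr_deriv ?_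
    module)
  have h3 := iteratedDeriv_succ_eventuallyEq (g' := fun y =>
      iteratedDeriv 3 ω y • iteratedDeriv 1 q (ω y) +
        (3 * iteratedDeriv 1 ω y * iteratedDeriv 2 ω y) • iteratedDeriv 2 q (ω y) +
        iteratedDeriv 1 ω y ^ 3 • iteratedDeriv 3 q (ω y)) h2 (by
    filter_upwards [hev] with y ⟨hqy, hωy⟩
    refine (((hωy.hasDerivAt_iteratedDeriv 2).smul
      (hasDerivAt_iteratedDeriv_comp hqy hωy 1)).add
      (((hωy.hasDerivAt_iteratedDeriv 1).pow 2).smul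
      (hasDerivAt_iteratedDeriv_comp hqy hωy 2))).congr_deriv ?_
    norm_num
    module)
  refine ⟨h1, h2, h3, iteratedDeriv_succ_eventuallyEq h3 ?_⟩
  filter_upwards [hev] with y ⟨hqy, hωy⟩
  refine ((((hωy.hasDerivAt_iteratedDeriv 3).smul
    (hasDerivAt_iteratedDeriv_comp hqy hωy 1)).add
    ((((hωy.hasDerivAt_iteratedDeriv 1).const_mul 3).mul
      (hωy.hasDerivAt_iteratedDeriv 2)).smul
    (hasDerivAt_iteratedDeriv_comp hqy hωy 2))).add
    (((hωy.hasDerivAt_iteratedDeriv 1).pow 3).smul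
    (hasDerivAt_iteratedDeriv_comp hqy hωy 3))).congr_deriv ?_
  norm_num
  module

end Composition

section Moebius

variable {a b c d : ℂ} {ω : ℂ → ℂ} {z : ℂ}

theorem hasDerivAt_const_mul_inv_pow (C : ℂ) (k : ℕ) (hz : c * z + d ≠ 0) :
    HasDerivAt (fun y => C * ((c * y + d)⁻¹) ^ k)
      (-(k * c * C) * ((c * z + d)⁻¹) ^ (k + 1)) z := by
  have hlin : HasDerivAt (fun y => c * y + d) c z := by
    simpa using ((hasDerivAt_id z).const_mul c).add_const d
  refine (((hlin.fun_inv hz).fun_pow k).const_mul C).congr_deriv ?_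
  rcases k with _ | k
  · simp
  · simp only [Nat.add_sub_cancel, div_eq_mul_inv, ← inv_pow]
    ring

theorem analyticAt_moebius (hω : ∀ z, ω z = (a * z + b) / (c * z + d)) (hz : c * z + d ≠ 0) :
    AnalyticAt ℂ ω z := by
  rw [funext hω]
  fun_prop (disch := exact hz)

theorem iteratedDeriv_moebius (hω : ∀ z, ω z = (a * z + b) / (c * z + d)) (hz : c * z + d ≠ 0) :
    iteratedDeriv 1 ω z = (a * d - b * c) * ((c * z + d)⁻¹) ^ 2 ∧
      iteratedDeriv 2 ω z = -(2 * c * (a * d - b * c)) * ((c * z + d)⁻¹) ^ 3 ∧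
      iteratedDeriv 3 ω z = 6 * c ^ 2 * (a * d - b * c) * ((c * z + d)⁻¹) ^ 4 ∧
      iteratedDeriv 4 ω z = -(24 * c ^ 3 * (a * d - b * c)) * ((c * z + d)⁻¹) ^ 5 := by
  have hev : ∀ᶠ y in 𝓝 z, c * y + d ≠ 0 :=
    ContinuousAt.eventually_ne (by fun_prop) hz
  have h1 : iteratedDeriv 1 ω =ᶠ[𝓝 z] fun y => (a * d - b * c) * ((c * y + d)⁻¹) ^ 2 := by
    refine iteratedDeriv_succ_eventuallyEq (g := ω) (by simp) ?_
    filter_upwards [hev] with y hy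
    have hnum : HasDerivAt (fun y => a * y + b) a y := by
      simpa using ((hasDerivAt_id y).const_mul a).add_const b
    have hden : HasDerivAt (fun y => c * y + d) c y := by
      simpa using ((hasDerivAt_id y).const_mul c).add_const d
    rw [funext hω]
    refine (hnum.fun_div hden hy).congr_deriv ?_
    field_simp
    ring
  have h2 := iteratedDeriv_succ_eventuallyEq h1
    (hev.mono fun y hy => hasDerivAt_const_mul_inv_pow _ 2 hy)
  have h3 := iteratedDeriv_succ_eventuallyEq h2
    (hev.mono fun y hy => hasDerivAt_const_mul_inv_pow _ 3 hy)
  have h4 := iteratedDeriv_succ_eventuallyEq h3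
    (hev.mono fun y hy => hasDerivAt_const_mul_inv_pow _ 4 hy)
  refine ⟨h1.eq_of_nhds, h2.eq_of_nhds.trans ?_, h3.eq_of_nhds.trans ?_,
    h4.eq_of_nhds.trans ?_⟩ <;> push_cast <;> ring

end Moebius


/-- Eq. `exsec2`, case `n = 3`: the expansion of `I₁, I₂, I₃` of
`q ∘ ω` for a Möbius transformation `ω` (indices `0, 1, 2 : Fin 3` encode `I₁, I₂, I₃`). -/
theorem exsec2_n3 (V : Set ℂ) (hV : IsOpen V)
    (q : ℂ → (Fin 3 → ℂ)) (hq : ∀ w ∈ V, AnalyticAt ℂ q w)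
    (a b c d : ℂ) (h : a * d - b * c ≠ 0)
    (ω : ℂ → ℂ) (hω : ∀ z, ω z = (a * z + b) / (c * z + d))
    (z : ℂ) (hz : c * z + d ≠ 0) (hzV : ω z ∈ V) (hΔ : Δmat 3 q (ω z) ≠ 0) :
    (deriv ω z) ^ 3 * Iinv 3 (q ∘ ω) 0 z =
        3 * (iteratedDeriv 2 ω z) ^ 3 +
          3 / 2 * (deriv ω z) ^ 2 * (iteratedDeriv 2 ω z) ^ 2 * Iinv 3 q 2 (ω z) -
          (deriv ω z) ^ 4 * iteratedDeriv 2 ω z * Iinv 3 q 1 (ω z) +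
          (deriv ω z) ^ 6 * Iinv 3 q 0 (ω z) ∧
      (deriv ω z) ^ 2 * Iinv 3 (q ∘ ω) 1 z =
        -9 * (iteratedDeriv 2 ω z) ^ 2 + (deriv ω z) ^ 4 * Iinv 3 q 1 (ω z) -
          3 * (deriv ω z) ^ 2 * iteratedDeriv 2 ω z * Iinv 3 q 2 (ω z) ∧
      deriv ω z * Iinv 3 (q ∘ ω) 2 z =
        6 * iteratedDeriv 2 ω z + (deriv ω z) ^ 2 * Iinv 3 q 2 (ω z) := by
  have hω_an := analyticAt_moebius hω hz
  obtain ⟨hu1, hu2, hu3, hu4⟩ := iteratedDeriv_comp_eventuallyEq (hq _ hzV) hω_an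
  replace hu1 := hu1.eq_of_nhds
  replace hu2 := hu2.eq_of_nhds
  replace hu3 := hu3.eq_of_nhds
  replace hu4 := hu4.eq_of_nhds
  obtain ⟨hw1, hw2, hw3, hw4⟩ := iteratedDeriv_moebius hω hz
  have hw1_ne : iteratedDeriv 1 ω z ≠ 0 := by
    rw [hw1]
    exact mul_ne_zero h (pow_ne_zero _ (inv_ne_zero hz))
  have hw13 : iteratedDeriv 3 ω z =
      3 / 2 * iteratedDeriv 2 ω z ^ 2 / iteratedDeriv 1 ω z := by
    rw [eq_div_iff hw1_ne, hw1, hw2, hw3]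
    ring
  have hw14 : iteratedDeriv 4 ω z = 3 * iteratedDeriv 2 ω z ^ 3 / iteratedDeriv 1 ω z ^ 2 := by
    rw [eq_div_iff (pow_ne_zero 2 hw1_ne), hw1, hw2, hw4]
    ring
  rw [← iteratedDeriv_one]
  clear hw1 hw2 hw3 hw4
  have hΔu : Δmat 3 (q ∘ ω) z = iteratedDeriv 1 ω z ^ 6 * Δmat 3 q (ω z) := by
    simp [Δmat, Dmat, Matrix.det_fin_three, hu1, hu2, hu3, -iteratedDeriv_one]
    ring
  have hA2 : Ainv 3 (q ∘ ω) 2 z = iteratedDeriv 1 ω z ^ 7 * Ainv 3 q 2 (ω z) +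
      6 * iteratedDeriv 1 ω z ^ 5 * iteratedDeriv 2 ω z * Δmat 3 q (ω z) := by
    simp [Ainv, Δmat, Dmat, Matrix.det_fin_three, hu1, hu2, hu4, -iteratedDeriv_one]
    ring
  have hA1 : Ainv 3 (q ∘ ω) 1 z = iteratedDeriv 1 ω z ^ 8 * Ainv 3 q 1 (ω z) -
      3 * iteratedDeriv 1 ω z ^ 6 * iteratedDeriv 2 ω z * Ainv 3 q 2 (ω z) -
      9 * iteratedDeriv 1 ω z ^ 4 * iteratedDeriv 2 ω z ^ 2 * Δmat 3 q (ω z) := by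
    simp [Ainv, Δmat, Dmat, Matrix.det_fin_three, hu1, hu3, hu4, hw13, -iteratedDeriv_one]
    field_simp
    ring
  have hA0 : Ainv 3 (q ∘ ω) 0 z = iteratedDeriv 1 ω z ^ 9 * Ainv 3 q 0 (ω z) -
      iteratedDeriv 1 ω z ^ 7 * iteratedDeriv 2 ω z * Ainv 3 q 1 (ω z) +
      3 / 2 * iteratedDeriv 1 ω z ^ 5 * iteratedDeriv 2 ω z ^ 2 * Ainv 3 q 2 (ω z) +
      3 * iteratedDeriv 1 ω z ^ 3 * iteratedDeriv 2 ω z ^ 3 * Δmat 3 q (ω z) := by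
    simp [Ainv, Δmat, Dmat, Matrix.det_fin_three, hu2, hu3, hu4, hw13, hw14,
      -iteratedDeriv_one]
    field_simp
    ring
  simp only [Iinv, hΔu, hA0, hA1, hA2]
  refine ⟨?_, ?_, ?_⟩ <;> field_simp <;> ring
end
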